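/- arXiv:math/0608225 — 5 statements merged into one kernel-verified Lean document; each statement's English description precedes it below -/
import Mathlib

section
/- Let E be a separable real Banach space and let μ be a weakly stable probability measure on E. Then for every probability measure λ on ℝ and every natural number k ≥ 1 there exists a probability measure ν on ℝ such that the k-fold convolution power (μ∘λ)^{*k} equals μ∘ν. (This is the key step in the proof of Lemma 2, producing the rational convolution powers λ^{k/n} of a μ-weakly infinitely divisible measure.) -/
open MeasureTheory

/-- The scale mixture `μ ∘ λ`: the distribution of `Θ • X` where `X ~ μ`, `Θ ~ λ` independent;
equivalently the pushforward of `λ ⊗ μ` under `(s, x) ↦ s • x`. -/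
noncomputable def scaleMix {E : Type*} [NormedAddCommGroup E] [NormedSpace ℝ E]
    [MeasurableSpace E] (μ : Measure E) (l : Measure ℝ) : Measure E :=
  (l.prod μ).map (fun p : ℝ × E => p.1 • p.2)

/-- A probability measure `μ` on `E` is weakly stable if for every pair of probability
measures `λ₁, λ₂` on `ℝ` there is a probability measure `λ` on `ℝ` with
`(μ∘λ₁) * (μ∘λ₂) = μ∘λ`. -/
def WeaklyStable {E : Type*} [NormedAddCommGroup E] [NormedSpace ℝ E]
    [MeasurableSpace E] (μ : Measure E) : Prop :=
  ∀ l₁ l₂ : Measure ℝ, IsProbabilityMeasure l₁ → IsProbabilityMeasure l₂ →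
    ∃ l : Measure ℝ, IsProbabilityMeasure l ∧ (scaleMix μ l₁) ∗ (scaleMix μ l₂) = scaleMix μ l

/-- The `k`-fold convolution power `ν^{*k}` of a measure (with `ν^{*1} = ν`). -/
noncomputable def convPow {E : Type*} [AddMonoid E] [MeasurableSpace E]
    (ν : Measure E) : ℕ → Measure E
  | 0 => Measure.dirac 0
  | k + 1 => (convPow ν k) ∗ ν

theorem scaleMix_isProbabilityMeasure {E : Type*} [NormedAddCommGroup E] [NormedSpace ℝ E]
    [SecondCountableTopology E] [MeasurableSpace E] [BorelSpace E]
    (μ : Measure E) [IsProbabilityMeasure μ] (l : Measure ℝ) [IsProbabilityMeasure l] :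
    IsProbabilityMeasure (scaleMix μ l) :=
  Measure.isProbabilityMeasure_map (by fun_prop)

/-- Key step in Lemma 2: if `μ` is weakly stable then every convolution power
`(μ∘λ)^{*k}` is again a scale mixture of `μ`. -/
theorem convPow_scaleMix_of_weaklyStable
    {E : Type*} [NormedAddCommGroup E] [NormedSpace ℝ E] [CompleteSpace E]
    [SecondCountableTopology E] [MeasurableSpace E] [BorelSpace E]
    (μ : Measure E) [IsProbabilityMeasure μ] (hμ : WeaklyStable μ) :
    ∀ (l : Measure ℝ), IsProbabilityMeasure l → ∀ k : ℕ, 1 ≤ k →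
      ∃ ν : Measure ℝ, IsProbabilityMeasure ν ∧ convPow (scaleMix μ l) k = scaleMix μ ν := by
  intro l hl k hk
  induction k, hk using Nat.le_induction with
  | base =>
    have := scaleMix_isProbabilityMeasure μ l
    exact ⟨l, hl, by simp only [convPow, Measure.dirac_zero_conv]⟩
  | succ k _ ih =>
    obtain ⟨ν, hν, h⟩ := ih
    obtain ⟨ρ, hρ, h'⟩ := hμ ν l hν hl
    exact ⟨ρ, hρ, by rw [convPow, h, h']⟩
end

section
/- Let E be a separable real Banach space, let μ be a probability measure on E with μ ≠ δ_0, and let λ be a probability measure on ℝ. Then λ is μ-weakly stable, i.e., for all a, b > 0 there exists c > 0 such that (μ∘(T_aλ)) * (μ∘(T_bλ)) = μ∘(T_cλ), if and only if the measure μ∘λ is strictly stable in the usual sense, i.e., for all a, b > 0 there exists c > 0 such that T_a(μ∘λ) * T_b(μ∘λ) = T_c(μ∘λ). (Lemma 3.) -/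
open MeasureTheory

/-- The rescaling operator `T_a`: pushforward under multiplication by `a` for `a ≠ 0`,
and `δ₀` for `a = 0`. -/
noncomputable def rescale {E : Type*} [NormedAddCommGroup E] [NormedSpace ℝ E]
    [MeasurableSpace E] (a : ℝ) (ν : Measure E) : Measure E :=
  if a = 0 then Measure.dirac 0 else ν.map (fun x => a • x)

/-- Rescaling the mixing measure by `a ≠ 0` rescales the scale mixture by `a`. -/
theorem scaleMix_rescale {E : Type*} [NormedAddCommGroup E] [NormedSpace ℝ E]
    [SecondCountableTopology E] [MeasurableSpace E] [BorelSpace E]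
    (μ : Measure E) [SFinite μ] (l : Measure ℝ) [SFinite l] {a : ℝ} (ha : a ≠ 0) :
    scaleMix μ (rescale a l) = rescale a (scaleMix μ l) := by
  have hs : Measurable fun p : ℝ × E => p.1 • p.2 := measurable_fst.smul measurable_snd
  have hr : Measurable fun x : ℝ => a • x := measurable_id.const_smul a
  have hE : Measurable fun x : E => a • x := measurable_id.const_smul a
  have hprod : (l.map fun x => a • x).prod μ = (l.prod μ).map (Prod.map (fun x => a • x) id) := by
    simpa using Measure.map_prod_map l μ hr measurable_id
  simp only [scaleMix, rescale, if_neg ha]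
  rw [hprod, Measure.map_map hs (hr.prodMap measurable_id), Measure.map_map hE hs]
  congr 1
  ext p
  simp [mul_smul]

/-- Lemma 3: `λ` is `μ`-weakly stable iff the scale mixture `μ∘λ` is strictly stable
in the usual sense. -/
theorem weaklyStable_iff_scaleMix_strictlyStable
    {E : Type*} [NormedAddCommGroup E] [NormedSpace ℝ E] [CompleteSpace E]
    [SecondCountableTopology E] [MeasurableSpace E] [BorelSpace E]
    (μ : Measure E) [IsProbabilityMeasure μ] (hμ : μ ≠ Measure.dirac 0)
    (l : Measure ℝ) [IsProbabilityMeasure l] :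
    (∀ a b : ℝ, 0 < a → 0 < b → ∃ c : ℝ, 0 < c ∧
        (scaleMix μ (rescale a l)) ∗ (scaleMix μ (rescale b l)) = scaleMix μ (rescale c l))
      ↔
    (∀ a b : ℝ, 0 < a → 0 < b → ∃ c : ℝ, 0 < c ∧
        (rescale a (scaleMix μ l)) ∗ (rescale b (scaleMix μ l)) = rescale c (scaleMix μ l)) := by
  refine forall₄_congr fun a b ha hb => exists_congr fun c => and_congr_right fun hc => ?_
  rw [scaleMix_rescale μ l ha.ne', scaleMix_rescale μ l hb.ne', scaleMix_rescale μ l hc.ne']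
end

section
/- Let n ≥ 2 and let ω_n be the uniform probability measure on the unit sphere S^{n-1} ⊂ ℝⁿ. Then ω_n is weakly stable: for every pair λ₁, λ₂ of probability measures on ℝ there exists a probability measure λ on [0, ∞) such that (ω_n∘λ₁) * (ω_n∘λ₂) = ω_n∘λ. (Example 1.) -/
open MeasureTheory

/-- The uniform (i.e. rotation-invariant) probability measure `ω_n` on the unit sphere
`S^{n-1} ⊂ ℝⁿ`, viewed as a measure on `ℝⁿ`: the normalization of the spherical part
`volume.toSphere` of Lebesgue measure, pushed forward to the ambient space. -/
noncomputable def uniformOnSphere (n : ℕ) : Measure (EuclideanSpace ℝ (Fin n)) :=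
  Measure.map Subtype.val
    ((((volume : Measure (EuclideanSpace ℝ (Fin n))).toSphere Set.univ)⁻¹ •
      (volume : Measure (EuclideanSpace ℝ (Fin n))).toSphere))

open scoped RealInnerProductSpace Pointwise

section ScaleMix

variable {E : Type*} [NormedAddCommGroup E] [InnerProductSpace ℝ E] [MeasurableSpace E]
  [BorelSpace E] [SecondCountableTopology E]

instance isProbabilityMeasure_scaleMix (μ : Measure E) (l : Measure ℝ) [IsProbabilityMeasure μ]
    [IsProbabilityMeasure l] : IsProbabilityMeasure (scaleMix μ l) :=
  Measure.isProbabilityMeasure_map (by fun_prop)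

/-- The function `x ↦ exp (i⟪f x, g x⟫)` is integrable against any finite measure. -/
lemma integrable_exp_inner_mul_I {X : Type*} [MeasurableSpace X] (μ : Measure X)
    [IsFiniteMeasure μ] {f g : X → E} (hf : Measurable f) (hg : Measurable g) :
    Integrable (fun x ↦ Complex.exp (⟪f x, g x⟫ * Complex.I)) μ := by
  refine Integrable.of_bound (C := 1) (by fun_prop) (ae_of_all _ fun x ↦ ?_)
  rw [Complex.norm_exp_ofReal_mul_I]

lemma charFun_scaleMix (μ : Measure E) (l : Measure ℝ) [IsFiniteMeasure μ] [IsFiniteMeasure l]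
    (t : E) : charFun (scaleMix μ l) t = ∫ s, charFun μ (s • t) ∂l := by
  rw [charFun_apply, scaleMix, integral_map (by fun_prop) (by fun_prop),
    integral_prod _ (integrable_exp_inner_mul_I _ (by fun_prop) measurable_const)]
  simp_rw [charFun_apply, inner_smul_left, inner_smul_right]
  rfl

lemma integral_charFun_smul_comm (μ ν : Measure E) [IsFiniteMeasure μ] [IsFiniteMeasure ν]
    (r : ℝ) : ∫ u, charFun ν (r • u) ∂μ = ∫ x, charFun μ (r • x) ∂ν := by
  simp_rw [charFun_apply]
  rw [integral_integral_swap]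
  · simp_rw [real_inner_smul_right, real_inner_comm]
  · exact integrable_exp_inner_mul_I (μ.prod ν) (f := fun p ↦ p.2) (g := fun p ↦ r • p.1)
      (by fun_prop) (by fun_prop)

/-- A measure invariant under linear isometries has a characteristic function depending only on
the norm. -/
lemma charFun_eq_of_norm_eq [CompleteSpace E] {μ : Measure E}
    (hμ : ∀ g : E ≃ₗᵢ[ℝ] E, μ.map g = μ) {s t : E} (h : ‖s‖ = ‖t‖) :
    charFun μ s = charFun μ t := by
  obtain ⟨g, rfl⟩ : ∃ g : E ≃ₗᵢ[ℝ] E, g s = t := ⟨_, Submodule.reflection_sub h⟩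
  conv_rhs => rw [← hμ g]
  rw [charFun_apply, charFun_apply, integral_map (by fun_prop) (by fun_prop)]
  simp

/-- If `μ` lives on the unit sphere and the characteristic functions of `μ` and `ν` depend only on
the norm, then `ν` is the scale mixture of `μ` by the law of the norm under `ν`. -/
lemma scaleMix_map_norm_eq [CompleteSpace E] {μ ν : Measure E} [IsProbabilityMeasure μ]
    [IsFiniteMeasure ν] (hμ_norm : ∀ᵐ u ∂μ, ‖u‖ = 1)
    (hμ : ∀ s t : E, ‖s‖ = ‖t‖ → charFun μ s = charFun μ t)
    (hν : ∀ s t : E, ‖s‖ = ‖t‖ → charFun ν s = charFun ν t) :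
    scaleMix μ (ν.map (‖·‖)) = ν := by
  have : IsFiniteMeasure (scaleMix μ (ν.map (‖·‖))) := by unfold scaleMix; infer_instance
  refine Measure.ext_of_charFun (funext fun t ↦ ?_)
  calc charFun (scaleMix μ (ν.map (‖·‖))) t
      = ∫ x, charFun μ (‖x‖ • t) ∂ν := by
        rw [charFun_scaleMix, integral_map (by fun_prop) (by fun_prop)]
    _ = ∫ x, charFun μ (‖t‖ • x) ∂ν := by
        congr 1 with x
        exact hμ _ _ (by simp [norm_smul, mul_comm])
    _ = ∫ u, charFun ν (‖t‖ • u) ∂μ := (integral_charFun_smul_comm μ ν ‖t‖).symm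
    _ = ∫ _, charFun ν t ∂μ := by
        refine integral_congr_ae (hμ_norm.mono fun u hu ↦ hν _ _ ?_)
        simp [norm_smul, hu]
    _ = charFun ν t := by simp

end ScaleMix

section UniformOnSphere

variable {n : ℕ}

lemma isProbabilityMeasure_uniformOnSphere (hn : n ≠ 0) :
    IsProbabilityMeasure (uniformOnSphere n) := by
  have : Nonempty (Fin n) := Fin.pos_iff_nonempty.1 (Nat.pos_of_ne_zero hn)
  have : NeZero (volume : Measure (EuclideanSpace ℝ (Fin n))).toSphere :=
    ⟨Measure.toSphere_ne_zero _⟩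
  exact Measure.isProbabilityMeasure_map (by fun_prop)

lemma ae_norm_eq_one_uniformOnSphere : ∀ᵐ u ∂(uniformOnSphere n), ‖u‖ = 1 := by
  rw [uniformOnSphere, ae_map_iff (by fun_prop) (measurableSet_eq_fun (by fun_prop) (by fun_prop))]
  exact ae_of_all _ fun u ↦ by simp

lemma map_uniformOnSphere (g : EuclideanSpace ℝ (Fin n) ≃ₗᵢ[ℝ] EuclideanSpace ℝ (Fin n)) :
    (uniformOnSphere n).map g = uniformOnSphere n := by
  ext s hs
  have hg : MeasurableSet (g ⁻¹' s) := g.continuous.measurable hs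
  rw [Measure.map_apply g.continuous.measurable hs, uniformOnSphere,
    Measure.map_apply measurable_subtype_coe hg, Measure.map_apply measurable_subtype_coe hs,
    Measure.smul_apply, Measure.smul_apply,
    Measure.toSphere_apply' _ (measurable_subtype_coe hg),
    Measure.toSphere_apply' _ (measurable_subtype_coe hs),
    ← g.symm.measurePreserving.measure_preimage_equiv
      (f := g.symm.toHomeomorph.toMeasurableEquiv) (Set.Ioo (0 : ℝ) 1 • _)]
  congr 3
  ext x
  simp only [Subtype.image_preimage_coe, Set.mem_preimage, Set.mem_smul]
  constructor
  · rintro ⟨r, hr, y, ⟨hy, hys⟩, h⟩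
    refine ⟨r, hr, g y, ⟨by simpa using hy, hys⟩, g.symm.injective ?_⟩
    rw [map_smul, g.symm_apply_apply]
    exact h
  · rintro ⟨r, hr, y, ⟨hy, hys⟩, rfl⟩
    exact ⟨r, hr, g.symm y, ⟨by simpa using hy, by simpa using hys⟩, (map_smul g.symm r y).symm⟩

end UniformOnSphere

/-- Example 1: the uniform distribution `ω_n` on the unit sphere `S^{n-1} ⊂ ℝⁿ`, `n ≥ 2`,
is weakly stable: for all probability measures `λ₁, λ₂` on `ℝ` there is a probability
measure `λ` concentrated on `[0, ∞)` with `(ω_n∘λ₁) * (ω_n∘λ₂) = ω_n∘λ`. -/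
theorem uniformOnSphere_weaklyStable {n : ℕ} (hn : 2 ≤ n)
    (l₁ l₂ : Measure ℝ) [IsProbabilityMeasure l₁] [IsProbabilityMeasure l₂] :
    ∃ l : Measure ℝ, IsProbabilityMeasure l ∧ l (Set.Iio 0) = 0 ∧
      (scaleMix (uniformOnSphere n) l₁) ∗ (scaleMix (uniformOnSphere n) l₂) =
        scaleMix (uniformOnSphere n) l := by
  have := isProbabilityMeasure_uniformOnSphere (n := n) (by omega)
  have hω (s t : EuclideanSpace ℝ (Fin n)) (h : ‖s‖ = ‖t‖) :
      charFun (uniformOnSphere n) s = charFun (uniformOnSphere n) t :=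
    charFun_eq_of_norm_eq map_uniformOnSphere h
  have hmix (l : Measure ℝ) [IsProbabilityMeasure l] (s t : EuclideanSpace ℝ (Fin n))
      (h : ‖s‖ = ‖t‖) :
      charFun (scaleMix (uniformOnSphere n) l) s = charFun (scaleMix (uniformOnSphere n) l) t := by
    simp_rw [charFun_scaleMix]
    congr 1 with r
    exact hω _ _ (by simp [norm_smul, h])
  refine ⟨_, Measure.isProbabilityMeasure_map (by fun_prop), ?_,
    (scaleMix_map_norm_eq ae_norm_eq_one_uniformOnSphere hω fun s t h ↦ ?_).symm⟩
  · rw [Measure.map_apply measurable_norm measurableSet_Iio]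
    have h_empty : (fun x : EuclideanSpace ℝ (Fin n) ↦ ‖x‖) ⁻¹' Set.Iio 0 = ∅ := by
      ext x
      simp
    rw [h_empty, measure_empty]
  · rw [charFun_conv, charFun_conv, hmix l₁ s t h, hmix l₂ s t h]
end

section
/- Let α and β be independent random variables uniformly distributed on [0, 2π], and let Θ₁, Θ₂ be real random variables such that Θ₁, Θ₂, α, β are (jointly) independent. Then the random variable ‖Θ₁(cos α, sin α) + Θ₂(cos β, sin β)‖₂ has the same distribution as (Θ₁² + Θ₂² + 2Θ₁Θ₂ cos α)^{1/2}. (Example 1, case n = 2.) -/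
open MeasureTheory

/-- The uniform probability distribution on the interval `[0, 2π]`. -/
noncomputable def uniformIcc2Pi : Measure ℝ :=
  (ENNReal.ofReal (2 * Real.pi))⁻¹ • (volume.restrict (Set.Icc 0 (2 * Real.pi)))

instance : SFinite uniformIcc2Pi := by
  unfold uniformIcc2Pi
  infer_instance

lemma Function.Periodic.setLIntegral_Ioc_sub_eq {T : ℝ} (hT : 0 < T) {g : ℝ → ENNReal}
    (hg : Function.Periodic g T) (b : ℝ) :
    ∫⁻ x in Set.Ioc 0 (0 + T), g (x - b) = ∫⁻ x in Set.Ioc 0 (0 + T), g x := by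
  have : Fact (0 < T) := ⟨hT⟩
  have h₁ := AddCircle.lintegral_preimage T 0 (fun y => hg.lift (y - (b : AddCircle T)))
  have h₂ := AddCircle.lintegral_preimage T 0 hg.lift
  rw [lintegral_sub_right_eq_self] at h₁
  exact h₁.trans h₂.symm

lemma lintegral_uniformIcc2Pi_sub_eq {g : ℝ → ENNReal}
    (hg : Function.Periodic g (2 * Real.pi)) (b : ℝ) :
    ∫⁻ x, g (x - b) ∂uniformIcc2Pi = ∫⁻ x, g x ∂uniformIcc2Pi := by
  have h := hg.setLIntegral_Ioc_sub_eq Real.two_pi_pos b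
  rw [zero_add] at h
  rw [uniformIcc2Pi, lintegral_smul_measure, lintegral_smul_measure,
    ← restrict_Ioc_eq_restrict_Icc, h]

lemma map_cos_sub_uniformIcc2Pi_prod :
    (uniformIcc2Pi.prod uniformIcc2Pi).map (fun p => Real.cos (p.1 - p.2)) =
      (uniformIcc2Pi.prod uniformIcc2Pi).map (fun p => Real.cos p.1) := by
  refine Measure.ext_of_lintegral _ fun f hf => ?_
  rw [lintegral_map hf (by fun_prop), lintegral_map hf (by fun_prop),
    lintegral_prod_symm _ (by fun_prop), lintegral_prod_symm _ (by fun_prop)]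
  exact lintegral_congr fun y =>
    lintegral_uniformIcc2Pi_sub_eq (g := fun x => f (Real.cos x)) (Real.cos_periodic.comp f) y

lemma norm_smul_circle_add_smul_circle (a b x y : ℝ) :
    ‖a • ((WithLp.equiv 2 (Fin 2 → ℝ)).symm ![Real.cos x, Real.sin x] :
        EuclideanSpace ℝ (Fin 2)) +
      b • ((WithLp.equiv 2 (Fin 2 → ℝ)).symm ![Real.cos y, Real.sin y] :
        EuclideanSpace ℝ (Fin 2))‖ =
      Real.sqrt (a ^ 2 + b ^ 2 + 2 * a * b * Real.cos (x - y)) := by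
  rw [EuclideanSpace.norm_eq]
  congr 1
  simp only [Fin.sum_univ_two, Real.norm_eq_abs, sq_abs, Real.cos_sub, PiLp.add_apply,
    PiLp.smul_apply, WithLp.equiv_symm_apply, smul_eq_mul, Matrix.cons_val_zero,
    Matrix.cons_val_one]
  linear_combination a ^ 2 * Real.sin_sq_add_cos_sq x + b ^ 2 * Real.sin_sq_add_cos_sq y

/-- Example 1, case `n = 2`: if `α, β` are uniform on `[0, 2π]` and `Θ₁, Θ₂, α, β` are
jointly independent, then `‖Θ₁(cos α, sin α) + Θ₂(cos β, sin β)‖₂` has the same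
distribution as `(Θ₁² + Θ₂² + 2Θ₁Θ₂ cos α)^{1/2}`. -/
theorem norm_sum_circle_eq_dist
    {Ω : Type*} [MeasurableSpace Ω] (P : Measure Ω) [IsProbabilityMeasure P]
    (Θ₁ Θ₂ α β : Ω → ℝ)
    (hΘ₁ : Measurable Θ₁) (hΘ₂ : Measurable Θ₂) (hα : Measurable α) (hβ : Measurable β)
    (hαlaw : Measure.map α P = uniformIcc2Pi)
    (hβlaw : Measure.map β P = uniformIcc2Pi)
    (hindep : Measure.map (fun ω => (Θ₁ ω, Θ₂ ω, α ω, β ω)) P =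
      (Measure.map Θ₁ P).prod ((Measure.map Θ₂ P).prod
        ((Measure.map α P).prod (Measure.map β P)))) :
    Measure.map (fun ω =>
        ‖Θ₁ ω • ((WithLp.equiv 2 (Fin 2 → ℝ)).symm ![Real.cos (α ω), Real.sin (α ω)] : EuclideanSpace ℝ (Fin 2)) +
          Θ₂ ω • ((WithLp.equiv 2 (Fin 2 → ℝ)).symm ![Real.cos (β ω), Real.sin (β ω)] : EuclideanSpace ℝ (Fin 2))‖) P =
      Measure.map (fun ω =>
        Real.sqrt (Θ₁ ω ^ 2 + Θ₂ ω ^ 2 + 2 * Θ₁ ω * Θ₂ ω * Real.cos (α ω))) P := by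
  simp only [norm_smul_circle_add_smul_circle]
  have : IsProbabilityMeasure (P.map Θ₁) := Measure.isProbabilityMeasure_map hΘ₁.aemeasurable
  have : IsProbabilityMeasure (P.map Θ₂) := Measure.isProbabilityMeasure_map hΘ₂.aemeasurable
  rw [hαlaw, hβlaw] at hindep
  have map_eq (c : ℝ × ℝ → ℝ) (hc : Measurable c) :
      P.map (fun ω => Real.sqrt (Θ₁ ω ^ 2 + Θ₂ ω ^ 2 + 2 * Θ₁ ω * Θ₂ ω * c (α ω, β ω))) =
        ((P.map Θ₁).prod ((P.map Θ₂).prod ((uniformIcc2Pi.prod uniformIcc2Pi).map c))).map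
          (fun q : ℝ × ℝ × ℝ =>
            Real.sqrt (q.1 ^ 2 + q.2.1 ^ 2 + 2 * q.1 * q.2.1 * q.2.2)) := by
    have h₁ := Measure.map_prod_map (P.map Θ₂) (uniformIcc2Pi.prod uniformIcc2Pi)
      measurable_id hc
    have h₂ := Measure.map_prod_map (P.map Θ₁)
      ((P.map Θ₂).prod (uniformIcc2Pi.prod uniformIcc2Pi)) measurable_id
      (measurable_id.prodMap hc)
    rw [Measure.map_id] at h₁ h₂
    rw [h₁, h₂, ← hindep, Measure.map_map (by fun_prop) (by fun_prop),
      Measure.map_map (by fun_prop) (by fun_prop)]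
    rfl
  rw [map_eq (fun p => Real.cos (p.1 - p.2)) (by fun_prop),
    map_eq (fun p => Real.cos p.1) (by fun_prop), map_cos_sub_uniformIcc2Pi_prod]
end

section
/- For every t ≥ 0, ∫₀^∞ e^{−tx} · (2π)^{−1/2} x^{−3/2} e^{−1/(2x)} dx = exp(−√(2t)). That is, the function f_{1/2}(x) = (2π)^{−1/2} x^{−3/2} e^{−1/(2x)} on (0, ∞) is a probability density whose Laplace transform is e^{−√(2t)} (the density of the one-sided 1/2-stable subordinator used in Example 3). -/
open MeasureTheory

open Filter Topology in
/-- FTC-2 on `(a, ∞)` for a nonnegative derivative, with a one-sided limit at `a`. -/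
theorem integral_Ioi_of_hasDerivAt_of_nonneg_of_tendsto {g g' : ℝ → ℝ} {a l m : ℝ}
    (hderiv : ∀ x ∈ Set.Ioi a, HasDerivAt g (g' x) x) (hpos : ∀ x ∈ Set.Ioi a, 0 ≤ g' x)
    (ha : Tendsto g (𝓝[>] a) (𝓝 l)) (htop : Tendsto g atTop (𝓝 m)) :
    ∫ x in Set.Ioi a, g' x = m - l := by
  have key := integral_Ioi_of_hasDerivAt_of_nonneg (g := Function.update g a l) (g' := g')
    (a := a) (l := m) ?_ ?_ hpos ?_
  · simpa using key
  · rw [continuousWithinAt_update_same]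
    simpa using ha
  · intro x hx
    refine (hderiv x hx).congr_of_eventuallyEq ?_
    filter_upwards [lt_mem_nhds hx] with y hy
    exact Function.update_of_ne hy.ne' _ _
  · refine htop.congr' ?_
    filter_upwards [eventually_gt_atTop a] with y hy
    exact (Function.update_of_ne hy.ne' _ _).symm

/-- The primitive of the Gaussian `s ↦ e^{-s²/2}` vanishing at `0`. -/
noncomputable def gaussianPrimitive (y : ℝ) : ℝ :=
  ∫ s in (0 : ℝ)..y, Real.exp (-(1 / 2) * s ^ 2)

namespace gaussianPrimitive

open Filter Topology

theorem hasDerivAt (y : ℝ) :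
    HasDerivAt gaussianPrimitive (Real.exp (-(1 / 2) * y ^ 2)) y := by
  have hc : Continuous fun s : ℝ => Real.exp (-(1 / 2) * s ^ 2) := by fun_prop
  exact (hc.integral_hasStrictDerivAt 0 y).hasDerivAt

theorem apply_zero : gaussianPrimitive 0 = 0 := by
  simp [gaussianPrimitive]

theorem apply_neg (y : ℝ) : gaussianPrimitive (-y) = -gaussianPrimitive y := by
  have h := intervalIntegral.integral_comp_neg (a := 0) (b := y)
    fun s : ℝ => Real.exp (-(1 / 2) * s ^ 2)
  simp only [neg_sq, neg_zero] at h
  rw [gaussianPrimitive, gaussianPrimitive, h, intervalIntegral.integral_symm]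

theorem tendsto_atTop :
    Tendsto gaussianPrimitive atTop (𝓝 (√(2 * Real.pi) / 2)) := by
  have h := intervalIntegral_tendsto_integral_Ioi (0 : ℝ)
    (integrable_exp_neg_mul_sq (b := 1 / 2) (by norm_num)).integrableOn tendsto_id
  rwa [integral_gaussian_Ioi, show Real.pi / (1 / 2) = 2 * Real.pi by ring] at h

theorem tendsto_atBot :
    Tendsto gaussianPrimitive atBot (𝓝 (-(√(2 * Real.pi) / 2))) := by
  refine (tendsto_atTop.comp tendsto_neg_atBot_atTop).neg.congr fun y => ?_
  simp [apply_neg]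

end gaussianPrimitive

/-- An antiderivative on `(0, ∞)` of `x ↦ x^{-3/2} e^{-1/(2x) - c²x/2}`. -/
noncomputable def halfStablePrimitive (c x : ℝ) : ℝ :=
  -(Real.exp (-c) * gaussianPrimitive (x ^ (-(1 / 2) : ℝ) - c * x ^ (1 / 2 : ℝ)) +
    Real.exp c * gaussianPrimitive (x ^ (-(1 / 2) : ℝ) + c * x ^ (1 / 2 : ℝ)))

namespace halfStablePrimitive

open Filter Topology

theorem hasDerivAt (c : ℝ) {x : ℝ} (hx : 0 < x) :
    HasDerivAt (halfStablePrimitive c)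
      (x ^ (-(3 / 2) : ℝ) * Real.exp (-1 / (2 * x) - c ^ 2 / 2 * x)) x := by
  have ha : HasDerivAt (fun y : ℝ => y ^ (-(1 / 2) : ℝ)) (-(1 / 2) * x ^ (-(3 / 2) : ℝ)) x := by
    convert! Real.hasDerivAt_rpow_const (p := -(1 / 2)) (Or.inl hx.ne') using 3
    norm_num
  have hb : HasDerivAt (fun y : ℝ => y ^ (1 / 2 : ℝ)) (1 / 2 * x ^ (-(1 / 2) : ℝ)) x := by
    convert! Real.hasDerivAt_rpow_const (p := 1 / 2) (Or.inl hx.ne') using 3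
    norm_num
  have ha2 : (x ^ (-(1 / 2) : ℝ)) ^ 2 = 1 / x := by
    rw [← Real.rpow_natCast, ← Real.rpow_mul hx.le]
    norm_num [Real.rpow_neg_one]
  have hb2 : (x ^ (1 / 2 : ℝ)) ^ 2 = x := by
    rw [← Real.rpow_natCast, ← Real.rpow_mul hx.le]
    norm_num
  have hab : x ^ (-(1 / 2) : ℝ) * x ^ (1 / 2 : ℝ) = 1 := by
    rw [← Real.rpow_add hx]
    norm_num
  have h := (((gaussianPrimitive.hasDerivAt _).comp x (ha.sub (hb.const_mul c))).const_mul
    (Real.exp (-c))).add (((gaussianPrimitive.hasDerivAt _).comp x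
      (ha.add (hb.const_mul c))).const_mul (Real.exp c)) |>.neg
  refine h.congr_deriv ?_
  simp only [← mul_assoc, ← Real.exp_add]
  have e1 : -c + -(1 / 2) * (x ^ (-(1 / 2) : ℝ) - c * x ^ (1 / 2 : ℝ)) ^ 2 =
      -1 / (2 * x) - c ^ 2 / 2 * x := by
    have : -1 / (2 * x) = -(1 / 2) * (1 / x) := by ring
    rw [this]
    linear_combination -(1 / 2) * ha2 - c ^ 2 / 2 * hb2 + c * hab
  have e2 : c + -(1 / 2) * (x ^ (-(1 / 2) : ℝ) + c * x ^ (1 / 2 : ℝ)) ^ 2 =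
      -1 / (2 * x) - c ^ 2 / 2 * x := by
    have : -1 / (2 * x) = -(1 / 2) * (1 / x) := by ring
    rw [this]
    linear_combination -(1 / 2) * ha2 - c ^ 2 / 2 * hb2 - c * hab
  simp only [Pi.sub_apply, Pi.add_apply, e1, e2]
  ring

theorem tendsto_nhdsGT_zero (c : ℝ) :
    Tendsto (halfStablePrimitive c) (𝓝[>] 0)
      (𝓝 (-((Real.exp (-c) + Real.exp c) * (√(2 * Real.pi) / 2)))) := by
  have ha : Tendsto (fun x : ℝ => x ^ (-(1 / 2) : ℝ)) (𝓝[>] 0) atTop :=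
    tendsto_rpow_neg_nhdsGT_zero (by norm_num)
  have hb : Tendsto (fun x : ℝ => c * x ^ (1 / 2 : ℝ)) (𝓝[>] 0) (𝓝 0) := by
    have : ContinuousAt (fun x : ℝ => c * x ^ (1 / 2 : ℝ)) 0 :=
      (Real.continuousAt_rpow_const _ _ (Or.inr (by norm_num))).const_mul c
    simpa using this.tendsto.mono_left nhdsWithin_le_nhds
  have hsub := gaussianPrimitive.tendsto_atTop.comp (ha.atTop_add hb.neg)
  have hadd := gaussianPrimitive.tendsto_atTop.comp (ha.atTop_add hb)
  rw [add_mul]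
  refine ((hsub.const_mul (Real.exp (-c))).add (hadd.const_mul (Real.exp c))).neg.congr
    fun x => ?_
  simp [halfStablePrimitive, sub_eq_add_neg]

theorem tendsto_atTop {c : ℝ} (hc : 0 ≤ c) :
    Tendsto (halfStablePrimitive c) atTop
      (𝓝 (-((-Real.exp (-c) + Real.exp c) * (√(2 * Real.pi) / 2)))) := by
  have ha : Tendsto (fun x : ℝ => x ^ (-(1 / 2) : ℝ)) atTop (𝓝 0) :=
    tendsto_rpow_neg_atTop (by norm_num)
  rcases hc.eq_or_lt with rfl | hc
  · have h := (gaussianPrimitive.hasDerivAt 0).continuousAt.tendsto.comp ha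
    rw [gaussianPrimitive.apply_zero] at h
    unfold halfStablePrimitive
    simpa using (h.add h).neg
  · have hb : Tendsto (fun x : ℝ => c * x ^ (1 / 2 : ℝ)) atTop atTop :=
      (tendsto_rpow_atTop (by norm_num)).const_mul_atTop hc
    have hsub := gaussianPrimitive.tendsto_atBot.comp
      (ha.add_atBot (tendsto_neg_atTop_atBot.comp hb))
    have hadd := gaussianPrimitive.tendsto_atTop.comp (ha.add_atTop hb)
    rw [add_mul, neg_mul_comm]
    refine ((hsub.const_mul (Real.exp (-c))).add (hadd.const_mul (Real.exp c))).neg.congr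
      fun x => ?_
    simp [halfStablePrimitive, sub_eq_add_neg]

end halfStablePrimitive

theorem integral_rpow_mul_exp_neg_inv_sub {c : ℝ} (hc : 0 ≤ c) :
    ∫ x in Set.Ioi (0 : ℝ), x ^ (-(3 / 2) : ℝ) * Real.exp (-1 / (2 * x) - c ^ 2 / 2 * x) =
      √(2 * Real.pi) * Real.exp (-c) := by
  rw [integral_Ioi_of_hasDerivAt_of_nonneg_of_tendsto
    (fun x hx => halfStablePrimitive.hasDerivAt c hx)
    (fun x hx => mul_nonneg (Real.rpow_nonneg (le_of_lt hx) _) (Real.exp_pos _).le)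
    (halfStablePrimitive.tendsto_nhdsGT_zero c) (halfStablePrimitive.tendsto_atTop hc)]
  ring

/-- Example 3: the function `f_{1/2}(x) = (2π)^{−1/2} x^{−3/2} e^{−1/(2x)}` on `(0, ∞)`
(the density of the one-sided `1/2`-stable subordinator) is a probability density with
Laplace transform `t ↦ e^{−√(2t)}`:
`∫₀^∞ e^{−tx} (2π)^{−1/2} x^{−3/2} e^{−1/(2x)} dx = exp(−√(2t))` for all `t ≥ 0`. -/
theorem laplace_one_sided_half_stable :
    ∀ t : ℝ, 0 ≤ t →
      ∫ x in Set.Ioi (0 : ℝ),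
          Real.exp (-(t * x)) *
            ((2 * Real.pi) ^ (-(1 / 2 : ℝ)) * x ^ (-(3 / 2 : ℝ)) *
              Real.exp (-1 / (2 * x))) =
        Real.exp (-Real.sqrt (2 * t)) := by
  intro t ht
  have hsq : √(2 * t) ^ 2 / 2 = t := by
    rw [Real.sq_sqrt (by positivity)]
    ring
  have hpos : 0 < √(2 * Real.pi) := by positivity
  calc
    _ = ∫ x in Set.Ioi (0 : ℝ), (√(2 * Real.pi))⁻¹ *
          (x ^ (-(3 / 2) : ℝ) * Real.exp (-1 / (2 * x) - √(2 * t) ^ 2 / 2 * x)) := by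
      congr 1
      funext x
      rw [hsq, sub_eq_add_neg, Real.exp_add, Real.rpow_neg (by positivity), ← Real.sqrt_eq_rpow]
      ring
    _ = Real.exp (-√(2 * t)) := by
      rw [integral_const_mul, integral_rpow_mul_exp_neg_inv_sub (Real.sqrt_nonneg _),
        inv_mul_cancel_left₀ hpos.ne']
end
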